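/- arXiv:1310.0897 — 9 statements merged into one kernel-verified Lean document; each statement's English description precedes it below -/
import Mathlib

section
/- Let G'(k) denote the least positive integer s such that every sufficiently large positive integer n can be written as a sum of at most s positive integers whose product is a perfect k-th power. For every composite positive integer k, one has G'(k) ≤ k + 2; that is, there exists a positive integer N such that every integer n ≥ N can be written as a sum of at most k + 2 positive integers x_1, ..., x_s (s ≤ k + 2) with x_1 · x_2 ⋯ x_s a perfect k-th power. -/
/-- For every composite positive integer `k`, `G'(k) ≤ k + 2`: there exists `N` such that
every integer `n ≥ N` is a sum of at most `k + 2` positive integers whose product is a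
perfect `k`-th power. -/
theorem composite_G'_le_add_two (k : ℕ) (hk : 1 < k) (hk' : ¬ k.Prime) :
    ∃ N : ℕ, ∀ n : ℕ, N ≤ n →
      ∃ l : List ℕ, l.length ≤ k + 2 ∧ (∀ x ∈ l, 0 < x) ∧ l.sum = n ∧
        ∃ x : ℕ, 0 < x ∧ l.prod = x ^ k := by
  obtain ⟨m, rfl⟩ : ∃ m, k = m + 1 := ⟨k - 1, by omega⟩
  refine ⟨(m + 1) * (2 + (2 * (m + 1)) ^ m * (m + 1) ^ m), fun n hn => ?_⟩
  obtain ⟨r, hr⟩ : ∃ r, r = n % (m + 1) + (m + 1) := ⟨_, rfl⟩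
  have hlt : n % (m + 1) < m + 1 := Nat.mod_lt _ (by omega)
  have hr0 : 0 < r := by omega
  have hpow : r ^ m * (m + 1) ^ m ≤ (2 * (m + 1)) ^ m * (m + 1) ^ m :=
    Nat.mul_le_mul_right _ (Nat.pow_le_pow_left (by omega) _)
  have hq : 2 + (2 * (m + 1)) ^ m * (m + 1) ^ m ≤ n / (m + 1) := by
    rw [Nat.le_div_iff_mul_le (by omega), mul_comm]
    exact hn
  obtain ⟨x, hx⟩ : ∃ x, n / (m + 1) = x + 2 + r ^ m * (m + 1) ^ m := 
    ⟨n / (m + 1) - 2 - r ^ m * (m + 1) ^ m, by omega⟩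
  have hn' := Nat.div_add_mod n (m + 1)
  refine ⟨r :: (r ^ m * (m + 1) ^ (m + 1)) :: List.replicate (m + 1) (x + 1), by simp, ?_, ?_,
    (x + 1) * r * (m + 1), by positivity, ?_⟩
  · intro y hy
    rw [List.mem_cons, List.mem_cons] at hy
    rcases hy with rfl | rfl | hy
    · exact hr0
    · positivity
    · rw [List.eq_of_mem_replicate hy]
      omega
  · rw [List.sum_cons, List.sum_cons, List.sum_replicate, smul_eq_mul]
    rw [hx] at hn'
    rw [← hn', pow_succ (m + 1) m]
    have : n % (m + 1) + (m + 1) = r := hr.symm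
    linear_combination hr
  · rw [List.prod_cons, List.prod_cons, List.prod_replicate, mul_pow, mul_pow, pow_succ r m]
    ring
end

section
/- Let k be a composite positive integer. Then every integer n > 2·k^(2k) can be written as a sum of exactly k + 2 positive integers whose product is a perfect k-th power. -/
/-- For composite `k`, every integer `n > 2 * k ^ (2 * k)` is a sum of exactly `k + 2`
positive integers whose product is a perfect `k`-th power. -/
theorem composite_sum_of_k_add_two (k : ℕ) (hk : 1 < k) (hk' : ¬ k.Prime)
    (n : ℕ) (hn : 2 * k ^ (2 * k) < n) :
    ∃ l : List ℕ, l.length = k + 2 ∧ (∀ x ∈ l, 0 < x) ∧ l.sum = n ∧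
      ∃ x : ℕ, 0 < x ∧ l.prod = x ^ k := by
  have hk0 : 0 < k := by omega
  obtain ⟨t, q, ht0, htk, hq⟩ : ∃ t q : ℕ, 0 < t ∧ t ≤ k ∧ n = t + k * q := by
    refine ⟨(n - 1) % k + 1, (n - 1) / k, by omega, Nat.mod_lt _ hk0, ?_⟩
    have := Nat.mod_add_div (n - 1) k
    omega
  obtain ⟨j, rfl⟩ : ∃ j, k = j + 1 := ⟨k - 1, by omega⟩
  have h1 : t ^ j * (j + 1) ^ (j + 1) ≤ (j + 1) ^ (2 * (j + 1)) := by
    calc t ^ j * (j + 1) ^ (j + 1) ≤ (j + 1) ^ j * (j + 1) ^ (j + 1) := by gcongr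
      _ = (j + 1) ^ (j + (j + 1)) := (pow_add _ _ _).symm
      _ ≤ _ := Nat.pow_le_pow_right hk0 (by omega)
  have h2 : j + 1 ≤ (j + 1) ^ (2 * (j + 1)) := Nat.le_self_pow (by omega) _
  have h3 : t ^ j * (j + 1) ^ (j + 1) = (j + 1) * (t ^ j * (j + 1) ^ j) := by ring
  have h4 : t ^ j * (j + 1) ^ j < q := by
    apply Nat.lt_of_mul_lt_mul_left (a := j + 1)
    omega
  obtain ⟨X, hX⟩ : ∃ X, q = t ^ j * (j + 1) ^ j + X := ⟨q - t ^ j * (j + 1) ^ j, by omega⟩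
  have hX0 : 0 < X := by omega
  have hv : 0 < t ^ j * (j + 1) ^ (j + 1) := by positivity
  refine ⟨t :: (t ^ j * (j + 1) ^ (j + 1)) :: List.replicate (j + 1) X, by simp, ?_, ?_,
    t * (j + 1) * X, by positivity, ?_⟩
  · intro x hx
    simp only [List.mem_cons, List.mem_replicate] at hx
    rcases hx with rfl | rfl | ⟨_, rfl⟩ <;> assumption
  · simp only [List.sum_cons, List.sum_replicate, smul_eq_mul]
    rw [hq, hX]; ring
  · simp only [List.prod_cons, List.prod_replicate]
    rw [mul_pow, mul_pow]; ring
end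

section
/- For every integer n ≥ 3 with n divisible by 3, there are no positive integers A, B, C, D satisfying A + B = C and A·B·C = D^n. -/
/-- For `n ≥ 3` divisible by 3, the system `A + B = C`, `A * B * C = D ^ n` has no
positive integer solutions. -/
theorem no_solutions_of_three_dvd (n : ℕ) (hn : 3 ≤ n) (h3 : 3 ∣ n) :
    ¬ ∃ A B C D : ℕ, 0 < A ∧ 0 < B ∧ 0 < C ∧ 0 < D ∧
      A + B = C ∧ A * B * C = D ^ n := by
  rintro ⟨A, B, C, D, hA, hB, hC, hD, hs, hp⟩
  subst hs
  obtain ⟨k, rfl⟩ := h3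
  rw [mul_comm 3 k, pow_mul] at hp
  obtain ⟨g, a, b, hg, hab, rfl, rfl⟩ := Nat.exists_coprime' (Nat.gcd_pos_of_pos_left B hA)
  have hgE : g ^ 3 ∣ (D ^ k) ^ 3 := ⟨a * b * (a + b), by rw [← hp]; ring⟩
  obtain ⟨F, hF⟩ := (Nat.pow_dvd_pow_iff (by norm_num)).1 hgE
  rw [hF] at hp
  have h1 : a * b * (a + b) = F ^ 3 := by
    apply Nat.eq_of_mul_eq_mul_left (pow_pos hg 3)
    linarith
  have ha : 0 < a := Nat.pos_of_mul_pos_right hA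
  have hb : 0 < b := Nat.pos_of_mul_pos_right hB
  have hac : Nat.Coprime a (a + b) := by simpa using hab
  have hbc : Nat.Coprime b (a + b) := by simpa using hab.symm
  have h2 : Nat.Coprime (a * b) (a + b) := Nat.Coprime.mul_left hac hbc
  obtain ⟨u, hu⟩ := exists_eq_pow_of_mul_eq_pow (by rw [Nat.isUnit_iff]; exact h2) h1
  obtain ⟨z, hz⟩ := exists_eq_pow_of_mul_eq_pow (by rw [Nat.isUnit_iff]; exact h2.symm)
    ((mul_comm _ _).trans h1)
  obtain ⟨x, hx⟩ := exists_eq_pow_of_mul_eq_pow (by rw [Nat.isUnit_iff]; exact hab) hu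
  obtain ⟨y, hy⟩ := exists_eq_pow_of_mul_eq_pow (by rw [Nat.isUnit_iff]; exact hab.symm)
    ((mul_comm _ _).trans hu)
  refine fermatLastTheoremThree x y z ?_ ?_ ?_ (by rw [← hx, ← hy, ← hz])
  · rintro rfl; simp at hx; omega
  · rintro rfl; simp at hy; omega
  · rintro rfl; simp at hz; omega
end

section
/- Let p be a prime with p ≡ 3 (mod 8) and let k be a positive integer. Then there are no positive integers A, B, C, D satisfying A + B = C, A·B·C = D^4, and gcd(A, B, C) = p^k. -/
theorem aux_neg_sq {p x y : ℕ} (hp : p.Prime) (h4 : p % 8 = 3) (h : p ∣ x ^ 2 + y ^ 2) :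
    p ∣ y := by
  have := Fact.mk hp
  by_contra hy
  have hy' : (y : ZMod p) ≠ 0 := by rwa [Ne, ZMod.natCast_eq_zero_iff]
  have h1 : ((x ^ 2 + y ^ 2 : ℕ) : ZMod p) = 0 := (ZMod.natCast_eq_zero_iff _ _).2 h
  push_cast at h1
  exact ZMod.mod_four_ne_three_of_sq_eq_neg_sq' hy' (eq_neg_of_add_eq_zero_left h1) (by omega)

theorem aux_two {p a b c : ℕ} (hp : p.Prime) (h4 : p % 8 = 3) (h : b ^ 2 + b ^ 2 + p * a = c ^ 2) :
    p ∣ b := by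
  have := Fact.mk hp
  by_contra hy
  have hy' : (b : ZMod p) ≠ 0 := by rwa [Ne, ZMod.natCast_eq_zero_iff]
  have h1 : ((b ^ 2 + b ^ 2 + p * a : ℕ) : ZMod p) = ((c ^ 2 : ℕ) : ZMod p) := by rw [h]
  push_cast at h1
  have h2 : IsSquare (2 : ZMod p) := by
    refine ⟨c / b, ?_⟩
    field_simp
    rw [← h1]
    simp
    ring
  rw [ZMod.exists_sq_eq_two_iff (by rintro rfl; omega)] at h2
  omega

theorem aux_pow {x y t : ℕ} (n : ℕ) (hc : Nat.Coprime x y) (h : x * y = t ^ n) :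
    (∃ u, x = u ^ n) ∧ ∃ v, y = v ^ n := by
  constructor
  · obtain ⟨u, hu⟩ := exists_associated_pow_of_mul_eq_pow (Nat.isUnit_iff.2 hc) h
    exact ⟨u, (associated_iff_eq.1 hu).symm⟩
  · obtain ⟨u, hu⟩ := exists_associated_pow_of_mul_eq_pow (Nat.isUnit_iff.2 hc.symm)
      (by rw [mul_comm]; exact h : y * x = t ^ n)
    exact ⟨u, (associated_iff_eq.1 hu).symm⟩

theorem aux_S {d x y t : ℕ} (hd : d.Prime) (hc : Nat.Coprime x y) (h : x * y = d * t ^ 2) :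
    (∃ u v, x = d * u ^ 2 ∧ y = v ^ 2) ∨ (∃ u v, x = u ^ 2 ∧ y = d * v ^ 2) := by
  rcases (hd.dvd_mul).1 (Dvd.intro _ h.symm : d ∣ x * y) with ⟨x', rfl⟩ | ⟨y', rfl⟩
  · left
    have h1 : x' * y = t ^ 2 := Nat.eq_of_mul_eq_mul_left hd.pos (by rw [← h]; ring)
    obtain ⟨⟨u, rfl⟩, v, rfl⟩ := aux_pow 2 (Nat.Coprime.coprime_mul_left hc) h1
    exact ⟨u, v, rfl, rfl⟩
  · right
    have h1 : x * y' = t ^ 2 := Nat.eq_of_mul_eq_mul_left hd.pos (by rw [← h]; ring)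
    obtain ⟨⟨u, rfl⟩, v, rfl⟩ := aux_pow 2 (Nat.Coprime.coprime_mul_left_right hc) h1
    exact ⟨u, v, rfl, rfl⟩

theorem aux_four {d s q t : ℕ} (hd : d = 1 ∨ (d.Prime ∧ d % 8 = 3))
    (hc : Nat.Coprime s q) (hq : Odd q)
    (h : s * ((s + q) * (q * (2 * s + q))) = d * t ^ 2) :
    ∃ b a e c, s = d * b ^ 2 ∧ s + q = a ^ 2 ∧ q = e ^ 2 ∧ 2 * s + q = c ^ 2 := by
  have hq2 : Nat.Coprime 2 q := (Nat.coprime_two_left).2 hq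
  have c1 : Nat.Coprime s (s + q) := by simpa using hc
  have c2 : Nat.Coprime s (2 * s + q) := by simpa using hc
  have c3 : Nat.Coprime (s + q) q := by simpa using hc
  have c4 : Nat.Coprime (s + q) (2 * s + q) := by
    rw [show 2 * s + q = s + (s + q) by ring]; simpa using hc.symm
  have c5 : Nat.Coprime q (2 * s + q) := by
    have : Nat.Coprime (2 * s) q := Nat.Coprime.mul_left hq2 hc
    simpa using this.symm
  have k1 : Nat.Coprime q (2 * s + q) := c5
  have k2 : Nat.Coprime (s + q) (q * (2 * s + q)) := Nat.Coprime.mul_right c3 c4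
  have k3 : Nat.Coprime s ((s + q) * (q * (2 * s + q))) :=
    Nat.Coprime.mul_right c1 (Nat.Coprime.mul_right hc c2)
  rcases hd with rfl | ⟨hd, h8⟩
  · rw [one_mul] at h
    obtain ⟨⟨b, hb⟩, v, hv⟩ := aux_pow 2 k3 h
    obtain ⟨⟨a, ha⟩, v, hv⟩ := aux_pow 2 k2 hv
    obtain ⟨⟨e, he⟩, c, hc'⟩ := aux_pow 2 k1 hv
    exact ⟨b, a, e, c, by rw [one_mul]; exact hb, ha, he, hc'⟩
  have hd1 : ∀ x y, Nat.Coprime x y → d ∣ x → d ∣ y → False := fun x y h1 h2 h3 =>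
    hd.one_lt.ne' (Nat.dvd_one.1 (h1 ▸ Nat.dvd_gcd h2 h3))
  rcases aux_S hd k3 h with ⟨b, v, hb, hv⟩ | ⟨b, v, hb, hv⟩
  · obtain ⟨⟨a, ha⟩, v, hv⟩ := aux_pow 2 k2 hv
    obtain ⟨⟨e, he⟩, c, hc'⟩ := aux_pow 2 k1 hv
    exact ⟨b, a, e, c, hb, ha, he, hc'⟩
  exfalso
  rcases aux_S hd k2 hv with ⟨a, v, ha, hv⟩ | ⟨a, v, ha, hv⟩
  · obtain ⟨⟨e, he⟩, c, hc'⟩ := aux_pow 2 k1 hv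
    have h1 : d ∣ e ^ 2 + b ^ 2 := ⟨a ^ 2, by rw [← he, ← hb, ← ha]; ring⟩
    have h2 : d ∣ s := hb ▸ dvd_pow (aux_neg_sq hd h8 h1) two_ne_zero
    exact hd1 _ _ c1 h2 ⟨_, ha⟩
  rcases aux_S hd k1 hv with ⟨e, c, he, hc'⟩ | ⟨e, c, he, hc'⟩
  · have h1 : b ^ 2 + b ^ 2 + d * e ^ 2 = c ^ 2 := by rw [← he, ← hb, ← hc']; ring
    have h2 : d ∣ s := hb ▸ dvd_pow (aux_two hd h8 h1) two_ne_zero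
    exact hd1 _ _ hc h2 ⟨_, he⟩
  · have h1 : d ∣ a ^ 2 + b ^ 2 := ⟨c ^ 2, by rw [← hc', ← hb, ← ha]; ring⟩
    have h2 : d ∣ s := hb ▸ dvd_pow (aux_neg_sq hd h8 h1) two_ne_zero
    exact hd1 _ _ c2 h2 ⟨_, hc'⟩

/-- Pythagorean step. -/
theorem aux_pyth {u v a : ℕ} (hu : Odd u) (hv : 0 < v) (hc : Nat.Coprime u v)
    (h : u ^ 2 + v ^ 2 = a ^ 2) :
    ∃ s q : ℕ, 0 < s ∧ 0 < q ∧ Nat.Coprime s q ∧ Odd q ∧ u = q * (2 * s + q) ∧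
      v = 2 * (s * (s + q)) ∧ s + q < a := by
  have hu0 : 0 < u := hu.pos
  have ha : 0 < a := by
    rcases Nat.eq_zero_or_pos a with rfl | h'
    · nlinarith
    · exact h'
  have hp : PythagoreanTriple (u : ℤ) v a := by
    unfold PythagoreanTriple
    exact_mod_cast (by nlinarith : u * u + v * v = a * a)
  obtain ⟨m, n, h1, h2, h3, h4, h5, h6⟩ := hp.coprime_classification'
    (by simpa [Int.gcd_natCast_natCast] using hc) (by obtain ⟨w, rfl⟩ := hu; push_cast; omega)
    (by exact_mod_cast ha)
  have hv' : (0 : ℤ) < v := by exact_mod_cast hv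
  have hu' : (0 : ℤ) < u := by exact_mod_cast hu0
  have hm : 0 < m := lt_of_le_of_ne h6 (by rintro rfl; simp at h2; omega)
  have hn : 0 < n := by by_contra hn; nlinarith
  have hmn : n < m := by by_contra hn; nlinarith
  lift m to ℕ using h6
  lift n to ℕ using hn.le
  obtain ⟨q, rfl⟩ : ∃ q, m = n + q := ⟨m - n, by omega⟩
  refine ⟨n, q, by omega, by omega, ?_, ?_, ?_, ?_, ?_⟩
  · rw [Int.gcd_natCast_natCast] at h4
    have : Nat.Coprime (n + q) n := h4
    simpa using this.symm
  · rw [Nat.odd_iff]; omega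
  · zify; rw [h1]; push_cast; ring
  · zify; rw [h2]; push_cast; ring
  · zify; rw [h3]; push_cast at *; nlinarith

theorem aux_N {d : ℕ} (hd : d = 1 ∨ (d.Prime ∧ d % 8 = 3)) (N : ℕ) :
    ∀ s q t : ℕ, s + q = N → 0 < s → 0 < q → Nat.Coprime s q → Odd q →
      s * ((s + q) * (q * (2 * s + q))) = d * t ^ 2 → False := by
  induction N using Nat.strong_induction_on with
  | _ N ih =>
  intro s q t hN hs hq hc hodd h
  have hdodd : Odd d := by
    rw [Nat.odd_iff]; omega
  obtain ⟨b, a, e, c, hb, ha, he, hc'⟩ := aux_four hd hc hodd h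
  have heo : Odd e := by
    rw [he] at hodd; exact (Nat.odd_pow_iff two_ne_zero).1 hodd
  have hco : Odd c := by
    have : Odd (c ^ 2) := by rw [← hc']; exact Even.add_odd (even_two_mul s) hodd
    exact (Nat.odd_pow_iff two_ne_zero).1 this
  have hlt : e < c := by
    by_contra hh
    have : c ^ 2 ≤ e ^ 2 := Nat.pow_le_pow_left (by omega) 2
    omega
  obtain ⟨v, hv⟩ : ∃ v, c = e + 2 * v := by
    rw [Nat.odd_iff] at heo hco
    exact ⟨(c - e) / 2, by omega⟩
  -- u = e + v
  subst hv
  have hv0 : 0 < v := by omega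
  have hs2 : s = 2 * ((e + v) * v) := by
    have : 2 * s + e ^ 2 = (e + 2 * v) ^ 2 := by rw [← hc', ← he]
    nlinarith
  have ha2 : (e + v) ^ 2 + v ^ 2 = a ^ 2 := by
    rw [← ha, hs2, he]; ring
  have hcuv : Nat.Coprime (e + v) v := by
    have : Nat.Coprime v e := by
      refine Nat.Coprime.of_dvd ?_ ?_ hc
      · rw [hs2]; exact ⟨2 * (e + v), by ring⟩
      · rw [he]; exact ⟨e, by ring⟩
    simpa using this.symm
  have hbe : ∃ b', (e + v) * v = 2 * (d * b' ^ 2) := by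
    have hev : Even (d * b ^ 2) := by rw [← hb, hs2]; exact even_two_mul _
    have hbe : Even b := by
      rcases Nat.even_mul.1 hev with h1 | h1
      · exact absurd h1 (Nat.not_even_iff_odd.2 hdodd)
      · exact (Nat.even_pow.1 h1).1
    obtain ⟨b', rfl⟩ := hbe
    exact ⟨b', by rw [hb] at hs2; nlinarith⟩
  obtain ⟨b', hb'⟩ := hbe
  have haN : a ≤ N := by
    rw [← hN, ha]; exact Nat.le_self_pow two_ne_zero a
  rcases Nat.even_or_odd v with hve | hvo
  · obtain ⟨s', q', h1, h2, h3, h4, h5, h6, h7⟩ := aux_pyth (heo.add_even hve) hv0 hcuv ha2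
    refine ih (s' + q') (by omega) s' q' b' rfl h1 h2 h3 h4 ?_
    have : q' * (2 * s' + q') * (2 * (s' * (s' + q'))) = 2 * (d * b' ^ 2) := by
      rw [← h5, ← h6]; exact hb'
    refine Nat.eq_of_mul_eq_mul_left two_pos ?_
    rw [← this]; ring
  · obtain ⟨s', q', h1, h2, h3, h4, h5, h6, h7⟩ :=
      aux_pyth (a := a) hvo (by omega) hcuv.symm (by rw [← ha2]; ring)
    refine ih (s' + q') (by omega) s' q' b' rfl h1 h2 h3 h4 ?_
    rw [h6] at hb'
    have : 2 * (s' * (s' + q')) * (q' * (2 * s' + q')) = 2 * (d * b' ^ 2) := by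
      rw [← h5]; exact hb'
    refine Nat.eq_of_mul_eq_mul_left two_pos ?_
    rw [← this]; ring

theorem aux_Q {d x w z : ℕ} (hd : d = 1 ∨ (d.Prime ∧ d % 8 = 3)) (hx : 0 < x) (hw : 0 < d * w ^ 2)
    (hc : Nat.Coprime x z) (h : x ^ 4 + d * w ^ 2 = z ^ 4) : False := by
  have hdodd : Odd d := by
    rw [Nat.odd_iff]; omega
  have hlt : x ^ 2 < z ^ 2 := by
    by_contra hh
    have : (z ^ 2) ^ 2 ≤ (x ^ 2) ^ 2 := Nat.pow_le_pow_left (by omega) 2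
    ring_nf at this h hw
    omega
  have hc2 : Nat.Coprime (x ^ 2) (z ^ 2) := Nat.Coprime.pow 2 2 hc
  obtain ⟨q, hq⟩ : ∃ q, z ^ 2 = x ^ 2 + q := ⟨z ^ 2 - x ^ 2, by omega⟩
  have hq0 : 0 < q := by omega
  have hqw : q * (2 * x ^ 2 + q) = d * w ^ 2 := by
    have : z ^ 4 = (x ^ 2 + q) ^ 2 := by rw [← hq]; ring
    nlinarith
  rw [hq] at hc2
  rcases Nat.even_or_odd q with hqe | hqo
  · obtain ⟨s, hs⟩ := hqe
    have hxo : Odd (x ^ 2) := by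
      rw [← Nat.not_even_iff_odd]
      intro hev
      have h1 : 2 ∣ x ^ 2 := hev.two_dvd
      have h2 : 2 ∣ x ^ 2 + q := Dvd.dvd.add h1 ⟨s, by omega⟩
      have := Nat.dvd_gcd h1 h2
      rw [hc2] at this
      omega
    have hwe : Even w := by
      have : Even (d * w ^ 2) := by rw [← hqw, hs]; exact Even.mul_right ⟨s, rfl⟩ _
      rcases Nat.even_mul.1 this with h1 | h1
      · exact absurd h1 (Nat.not_even_iff_odd.2 hdodd)
      · exact (Nat.even_pow.1 h1).1
    obtain ⟨w', rfl⟩ := hwe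
    have hsw : s * (s + x ^ 2) = d * w' ^ 2 := by
      subst hs; nlinarith
    refine aux_N hd _ s (x ^ 2) (w' * x * z) rfl (by omega) (by positivity) ?_ hxo ?_
    · have : Nat.Coprime (x ^ 2) (s + s) := by rw [hs] at hc2; simpa using hc2
      exact (Nat.Coprime.of_dvd_right ⟨2, by ring⟩ this).symm
    · have : 2 * s + x ^ 2 = z ^ 2 := by omega
      rw [this]
      calc _ = (s * (s + x ^ 2)) * (x ^ 2 * z ^ 2) := by ring
        _ = _ := by rw [hsw]; ring
  · refine aux_N hd _ (x ^ 2) q (x * z * w) rfl (by positivity) hq0 (by simpa using hc2) hqo ?_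
    rw [hqw, ← hq]; ring

theorem aux_T {p f x y w : ℕ} (hp : p.Prime) (hc : Nat.Coprime x y) (h : p ^ f * (x * y) = w ^ 4) :
    ((∃ u, x = u ^ 4) ∧ ∃ v, p ^ f * y = v ^ 4) ∨ ((∃ u, p ^ f * x = u ^ 4) ∧ ∃ v, y = v ^ 4) := by
  by_cases hx : p ∣ x
  · right
    have hy : ¬ p ∣ y := fun hy => hp.one_lt.ne' (Nat.dvd_one.1 (hc ▸ Nat.dvd_gcd hx hy))
    have h1 : Nat.Coprime (p ^ f) y := Nat.Coprime.pow_left _ ((hp.coprime_iff_not_dvd).2 hy)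
    exact aux_pow 4 (Nat.Coprime.mul_left h1 hc) (by rw [← h]; ring)
  · left
    have h1 : Nat.Coprime (p ^ f) x := Nat.Coprime.pow_left _ ((hp.coprime_iff_not_dvd).2 hx)
    exact aux_pow 4 (Nat.Coprime.mul_right h1.symm hc) (by rw [← h]; ring)

theorem aux_D {p k y w : ℕ} (hp : p.Prime) (h : p ^ (3 * k) * y = w ^ 4) :
    (∃ V, y = V ^ 2) ∨ ∃ V, y = p * V ^ 2 := by
  rcases Nat.even_or_odd' k with ⟨j, rfl | rfl⟩
  · left
    have h1 : (p ^ (3 * j)) ^ 2 * y = (w ^ 2) ^ 2 := by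
      rw [← pow_mul, ← pow_mul, show 3 * j * 2 = 3 * (2 * j) by ring, h]
    obtain ⟨V, hV⟩ := (Nat.pow_dvd_pow_iff two_ne_zero).1 (Dvd.intro _ h1)
    refine ⟨V, Nat.eq_of_mul_eq_mul_left (pow_pos (pow_pos hp.pos (3 * j)) 2) ?_⟩
    rw [h1, hV]; ring
  · right
    have h1 : (p ^ (3 * j + 1)) ^ 2 * (p * y) = (w ^ 2) ^ 2 := by
      rw [← pow_mul w, ← h]; ring
    obtain ⟨V, hV⟩ := (Nat.pow_dvd_pow_iff two_ne_zero).1 (Dvd.intro _ h1)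
    have h2 : p * y = V ^ 2 := by
      refine Nat.eq_of_mul_eq_mul_left (pow_pos (pow_pos hp.pos (3 * j + 1)) 2) ?_
      rw [h1, hV]; ring
    obtain ⟨U, rfl⟩ := hp.dvd_of_dvd_pow (Dvd.intro _ h2)
    exact ⟨U, Nat.eq_of_mul_eq_mul_left hp.pos (by rw [h2]; ring)⟩

theorem aux_diff {p k x y z w : ℕ} (hp : p.Prime) (hp3 : p % 8 = 3) (hx : 0 < x ^ 4) (hy : 0 < y)
    (hc : Nat.Coprime (x ^ 4) (z ^ 4)) (hs : x ^ 4 + y = z ^ 4)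
    (h : p ^ (3 * k) * y = w ^ 4) : False := by
  have hc' : Nat.Coprime x z :=
    Nat.Coprime.of_dvd (dvd_pow_self x four_ne_zero) (dvd_pow_self z four_ne_zero) hc
  have hx' : 0 < x := Nat.pos_of_ne_zero (by rintro rfl; simp at hx)
  rcases aux_D hp h with ⟨V, hV⟩ | ⟨V, hV⟩
  · rw [← one_mul (V ^ 2)] at hV
    subst hV
    exact aux_Q (Or.inl rfl) hx' hy hc' hs
  · subst hV
    exact aux_Q (Or.inr ⟨hp, hp3⟩) hx' hy hc' hs

/-- If `p` is a prime with `p ≡ 3 (mod 8)` and `k ≥ 1`, the system `A + B = C`,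
`A * B * C = D ^ 4`, `gcd(A, B, C) = p ^ k` has no positive integer solutions. -/
theorem no_solutions_pow_four (p k : ℕ) (hp : p.Prime) (hp3 : p % 8 = 3) (hk : 0 < k) :
    ¬ ∃ A B C D : ℕ, 0 < A ∧ 0 < B ∧ 0 < C ∧ 0 < D ∧
      A + B = C ∧ A * B * C = D ^ 4 ∧ Nat.gcd A (Nat.gcd B C) = p ^ k := by
  rintro ⟨A, B, C, D, hA, hB, hC, hD, rfl, hprod, hg⟩
  have hg' : Nat.gcd A B = p ^ k := by simpa [Nat.gcd_comm] using hg
  have hP : 0 < p ^ k := pow_pos hp.pos k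
  obtain ⟨a, b, hab, ha, hb⟩ := Nat.exists_coprime A B
  rw [hg'] at ha hb
  have ha0 : 0 < a := Nat.pos_of_ne_zero (by rintro rfl; omega)
  have hb0 : 0 < b := Nat.pos_of_ne_zero (by rintro rfl; omega)
  have hpr : p ^ (3 * k) * (a * (b * (a + b))) = D ^ 4 := by
    rw [← hprod, ha, hb]; ring
  have hac : Nat.Coprime a (a + b) := by simpa using hab
  have hbc : Nat.Coprime b (a + b) := by simpa using hab.symm
  rcases aux_T hp (Nat.Coprime.mul_right hab hac) hpr with ⟨⟨x, hx⟩, v, hv⟩ | ⟨⟨u, hu⟩, v, hv⟩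
  · rcases aux_T hp hbc hv with ⟨⟨y, hy⟩, w, hw⟩ | ⟨⟨w, hw⟩, z, hz⟩
    · have hx' : x ≠ 0 := by rintro rfl; simp at hx; omega
      have hy' : y ≠ 0 := by rintro rfl; simp at hy; omega
      rcases aux_D hp hw with ⟨V, hV⟩ | ⟨V, hV⟩
      · refine not_fermat_42 (a := x) (b := y) (c := V) (by exact_mod_cast hx')
          (by exact_mod_cast hy') ?_
        rw [hx, hy] at hV
        exact_mod_cast hV
      · have h1 : p ∣ a + b := ⟨_, hV⟩
        have h2 : p ∣ y ^ 2 := by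
          refine aux_neg_sq (x := x ^ 2) hp hp3 ?_
          rw [hx, hy] at h1
          convert h1 using 1
          ring
        have h3 : p ∣ b := by
          rw [hy, show y ^ 4 = y ^ 2 * y ^ 2 by ring]
          exact Dvd.dvd.mul_right h2 _
        exact hp.one_lt.ne' (Nat.dvd_one.1 (hbc ▸ Nat.dvd_gcd h3 h1))
    · rw [hz] at hac
      rw [hx] at hac hz ha0
      exact aux_diff hp hp3 ha0 hb0 hac hz hw
  · obtain ⟨⟨y, hy⟩, z, hz⟩ := aux_pow 4 hbc hv
    rw [hz] at hbc
    rw [hy] at hbc hz hb0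
    exact aux_diff hp hp3 hb0 ha0 hbc (by rw [← hz]; ring) hu
end

section
/- Let n > 3 be a prime, let a, b, m be integers with m ≠ 0 and a + b = m^n, and suppose that (a^n + b^n)/(a + b) = p is an odd prime. Then p ≡ 1 (mod 2n). -/
theorem aux_sup (n : ℕ) (hn : Odd n) (a b : ℤ) (hs : 0 < a + b) :
    (a + b) ^ n ≤ 2 ^ (n - 1) * (a ^ n + b ^ n) := by
  have key : ∀ x y : ℤ, 0 < x + y → y < 0 → (x + y) ^ n ≤ 2 ^ (n - 1) * (x ^ n + y ^ n) := by
    intro x y h hy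
    have h1 : (x + y) ^ n + (-y) ^ n ≤ ((x + y) + (-y)) ^ n :=
      pow_add_pow_le h.le (by linarith) hn.pos.ne'
    rw [hn.neg_pow, add_neg_cancel_right] at h1
    have h2 : 0 < (x + y) ^ n := by positivity
    have h3 : (1 : ℤ) ≤ 2 ^ (n - 1) := one_le_pow₀ (by norm_num)
    nlinarith
  rcases lt_or_ge b 0 with hb | hb
  · exact key a b hs hb
  rcases lt_or_ge a 0 with ha | ha
  · have := key b a (by linarith) ha
    rwa [add_comm b a, add_comm (b ^ n)] at this
  · exact add_pow_le ha hb n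

theorem aux_big (n : ℕ) (hn : Odd n) (hn3 : 3 < n) (a b : ℤ) (hs : 2 * (n : ℤ) ≤ a + b)
    (h : (n : ℤ) * (a + b) = a ^ n + b ^ n) : False := by
  have h0 : (0 : ℤ) < n := by positivity
  have hs0 : 0 < a + b := by linarith
  have h1 := aux_sup n hn a b hs0
  rw [← h] at h1
  have h2 : (a + b) ^ n = (a + b) ^ (n - 1) * (a + b) := by
    rw [← pow_succ]; congr 1; omega
  rw [h2, ← mul_assoc] at h1
  have h3 := le_of_mul_le_mul_right h1 hs0
  have h4 : (2 * (n : ℤ)) ^ (n - 1) ≤ (a + b) ^ (n - 1) := by gcongr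
  rw [mul_pow] at h4
  have h5 := le_of_mul_le_mul_left (h4.trans h3) (by positivity)
  have h6 : (n : ℤ) ^ 1 < (n : ℤ) ^ (n - 1) :=
    pow_lt_pow_right₀ (by norm_cast; omega) (by omega)
  linarith

/-- If `n > 3` is prime, `a + b = m ^ n` with `m ≠ 0`, and `(a ^ n + b ^ n) / (a + b)`
is an odd prime `p`, then `p ≡ 1 (mod 2 n)`. -/
theorem prime_quotient_mod_two_mul (n : ℕ) (hn : n.Prime) (hn3 : 3 < n)
    (a b m : ℤ) (hm : m ≠ 0) (hab : a + b = m ^ n)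
    (p : ℕ) (hp : p.Prime) (hodd : Odd p)
    (hpq : (p : ℤ) * (a + b) = a ^ n + b ^ n) :
    p % (2 * n) = 1 := by
  have hno : Odd n := hn.odd_of_ne_two (by omega)
  have hnp : Prime (n : ℤ) := Nat.prime_iff_prime_int.mp hn
  have hs : a + b ≠ 0 := by rw [hab]; exact pow_ne_zero _ hm
  have : Fact n.Prime := ⟨hn⟩
  by_cases hd : (n : ℤ) ∣ a + b
  · exfalso
    have hnm : (n : ℤ) ∣ m := hnp.dvd_of_dvd_pow (hab ▸ hd)
    have hn2 : (n : ℤ) ^ 2 ∣ a + b := by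
      rw [hab]
      exact (pow_dvd_pow_of_dvd hnm 2).trans (pow_dvd_pow m (by omega))
    have habs : (n : ℤ) ^ 2 ≤ |a + b| :=
      Int.le_of_dvd (abs_pos.mpr hs) ((dvd_abs _ _).mpr hn2)
    have hn3' : (3 : ℤ) < n := by exact_mod_cast hn3
    have habs2 : 2 * (n : ℤ) ≤ |a + b| := by nlinarith
    have hgeom := (Commute.all a (-b)).geom_sum₂_mul n
    rw [hno.neg_pow, sub_neg_eq_add, sub_neg_eq_add, ← hpq] at hgeom
    have hq := mul_right_cancel₀ hs hgeom
    have hdp : (n : ℤ) ∣ p := by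
      rw [← hq]
      exact dvd_geom_sum₂_self (by simpa using hd)
    have hnp' : n = p := (Nat.prime_dvd_prime_iff_eq hn hp).mp (by exact_mod_cast hdp)
    subst hnp'
    rcases abs_cases (a + b) with ⟨h, _⟩ | ⟨h, _⟩
    · exact aux_big n hno hn3 a b (by linarith) hpq
    · refine aux_big n hno hn3 (-a) (-b) (by linarith) ?_
      rw [hno.neg_pow, hno.neg_pow]; linarith
  · have h1 : ((p : ℤ) : ZMod n) * ((a + b : ℤ) : ZMod n) = ((a + b : ℤ) : ZMod n) := by
      rw [← Int.cast_mul, hpq]; push_cast; rw [ZMod.pow_card, ZMod.pow_card]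
    have h2 : ((a + b : ℤ) : ZMod n) ≠ 0 := by
      rwa [Ne, ZMod.intCast_zmod_eq_zero_iff_dvd]
    have h3 := mul_eq_right₀ h2 |>.mp h1
    have h4 : p ≡ 1 [MOD n] := by
      rw [← ZMod.natCast_eq_natCast_iff]; simpa using h3
    have h5 : p ≡ 1 [MOD 2] := Nat.odd_iff.mp hodd
    have h6 : p ≡ 1 [MOD 2 * n] :=
      (Nat.modEq_and_modEq_iff_modEq_mul (Nat.coprime_two_left.mpr hno)).mp ⟨h5, h4⟩
    rw [h6, Nat.mod_eq_of_lt (by omega)]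
end

section
/- Let n > 3 be a prime with n ≡ r (mod 3) where 1 ≤ r ≤ 2, let a, b, m be integers with m ≠ 0 and a + b = m^n, and suppose that (a^n + b^n)/(a + b) = p is an odd prime. Then for every positive integer k with 3k ≡ rn − 1 (mod 3n) (equivalently, k ≡ (rn − 1)/3 (mod n), noting that 3 divides rn − 1), there exist nonzero integers A, B, C, D satisfying A + B = C, A·B·C = D^n, and gcd(A, B, C) = p^k. -/
theorem aux_coprime (n : ℕ) (ho : Odd n) (hn3 : 3 < n) (a b : ℤ) (h0 : a + b ≠ 0)
    (p : ℕ) (hp : p.Prime) (hpq : (p : ℤ) * (a + b) = a ^ n + b ^ n) : IsCoprime a b := by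
  rw [Int.isCoprime_iff_gcd_eq_one]
  have hg : Int.gcd a b ≠ 0 := by
    intro h
    rw [Int.gcd_eq_zero_iff] at h
    apply h0
    rw [h.1, h.2, add_zero]
  obtain ⟨a', ha⟩ := Int.gcd_dvd_left a b
  obtain ⟨b', hb⟩ := Int.gcd_dvd_right a b
  generalize Int.gcd a b = g at *
  have hg' : (g : ℤ) ≠ 0 := by exact_mod_cast hg
  obtain ⟨q, hq⟩ := ho.add_dvd_pow_add_pow a' b'
  have hab' : a' + b' ≠ 0 := by
    intro h
    apply h0
    rw [ha, hb, ← mul_add, h, mul_zero]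
  obtain ⟨t, rfl⟩ : ∃ t, n = t + 3 := ⟨n - 3, by omega⟩
  have h1 : (p : ℤ) = g * g * (g ^ t * q) := by
    have : (p : ℤ) * (g * (a' + b')) = (g * g * (g ^ t * q)) * (g * (a' + b')) := by
      have h2 : (p : ℤ) * (g * (a' + b')) = g ^ (t + 3) * (a' ^ (t+3) + b' ^ (t+3)) := by
        rw [mul_add (g : ℤ), ← ha, ← hb, hpq, ha, hb, mul_pow, mul_pow, mul_add]
      rw [h2, hq]; ring
    exact mul_right_cancel₀ (mul_ne_zero hg' hab') this
  have h3 : g * g ∣ p := by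
    have : ((g * g : ℕ) : ℤ) ∣ (p : ℤ) := ⟨_, by push_cast; exact h1⟩
    exact_mod_cast this
  exact Nat.isUnit_iff.mp (hp.prime.squarefree g h3)

theorem aux_ne (n : ℕ) (ho : Odd n) (a b : ℤ) (h0 : a + b ≠ 0) (hc : IsCoprime a b)
    (p : ℕ) (hp : p.Prime) (hpq : (p : ℤ) * (a + b) = a ^ n + b ^ n) : a ≠ 0 := by
  rintro rfl
  rw [isCoprime_zero_left, Int.isUnit_iff] at hc
  have hn0 : n ≠ 0 := by rintro rfl; simp at ho
  have h2 := hp.two_le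
  rcases hc with rfl | rfl
  · simp [hn0] at hpq; omega
  · simp [hn0, ho.neg_one_pow] at hpq; omega

/-- If `n > 3` is prime with `n ≡ r (mod 3)`, `1 ≤ r ≤ 2`, `a + b = m ^ n` with `m ≠ 0`,
and `(a ^ n + b ^ n) / (a + b)` is an odd prime `p`, then for every positive `k` with
`3 k ≡ r n − 1 (mod 3 n)` the system `A + B = C`, `A * B * C = D ^ n`,
`gcd(A, B, C) = p ^ k` has a solution in nonzero integers. -/
theorem exists_solution_of_special_prime (n r : ℕ) (hn : n.Prime) (hn3 : 3 < n)
    (hr : 1 ≤ r) (hr2 : r ≤ 2) (hnr : n % 3 = r)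
    (a b m : ℤ) (hm : m ≠ 0) (hab : a + b = m ^ n)
    (p : ℕ) (hp : p.Prime) (hodd : Odd p)
    (hpq : (p : ℤ) * (a + b) = a ^ n + b ^ n)
    (k : ℕ) (hk : 0 < k) (hkmod : (3 * k) % (3 * n) = (r * n - 1) % (3 * n)) :
    ∃ A B C D : ℤ, A ≠ 0 ∧ B ≠ 0 ∧ C ≠ 0 ∧ D ≠ 0 ∧
      A + B = C ∧ A * B * C = D ^ n ∧ Int.gcd A (Int.gcd B C) = p ^ k := by
  have ho : Odd n := hn.odd_of_ne_two (by omega)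
  have h0 : a + b ≠ 0 := by rw [hab]; exact pow_ne_zero _ hm
  have hc := aux_coprime n ho hn3 a b h0 p hp hpq
  have ha := aux_ne n ho a b h0 hc p hp hpq
  have hb := aux_ne n ho b a (by rwa [add_comm]) hc.symm p hp (by rw [add_comm, hpq, add_comm])
  have hp0 : (p : ℤ) ≠ 0 := by exact_mod_cast hp.ne_zero
  have hdiv : n ∣ 3 * k + 1 := by
    have h1 : 3 * k ≡ r * n - 1 [MOD n] := Nat.ModEq.of_mul_left 3 hkmod
    have h2 := h1.add_right 1
    have hrn : 0 < r * n := Nat.mul_pos hr hn.pos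
    rw [Nat.sub_add_cancel hrn] at h2
    exact (h2.dvd_iff dvd_rfl).mpr (dvd_mul_left n r)
  obtain ⟨s, hs⟩ := hdiv
  refine ⟨p ^ k * a ^ n, p ^ k * b ^ n, p ^ k * (p * m ^ n), p ^ s * (a * b * m),
    by positivity, by positivity, by positivity, by positivity, ?_, ?_, ?_⟩
  · rw [← hab, hpq]; ring
  · have : ((p : ℤ) ^ s * (a * b * m)) ^ n = p ^ (3 * k + 1) * (a * b * m) ^ n := by
      rw [hs, mul_pow, ← pow_mul, mul_comm s n]
    rw [this]; ring
  · have hcop : Int.gcd (a ^ n) (b ^ n) = 1 := Int.isCoprime_iff_gcd_eq_one.mp hc.pow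
    rw [Int.gcd_mul_left (p ^ k : ℤ) (b ^ n)]
    have : ((p ^ k : ℤ).natAbs) = p ^ k := by simp [Int.natAbs_pow]
    rw [this]
    push_cast
    rw [Int.gcd_mul_left, this, ← Int.gcd_assoc, hcop]
    simp
end

section
/- Let n > 3 be a prime with n ≡ r (mod 3) where 1 ≤ r ≤ 2, and suppose p = 2^n − 1 is a (Mersenne) prime. Then for every positive integer k with 3k ≡ rn − 1 (mod 3n) (equivalently, k ≡ (rn − 1)/3 (mod n)), there exist nonzero integers A, B, C, D satisfying A + B = C, A·B·C = D^n, and gcd(A, B, C) = p^k. -/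
/-- If `n > 3` is prime with `n ≡ r (mod 3)`, `1 ≤ r ≤ 2`, and `p = 2 ^ n - 1` is a
Mersenne prime, then for every positive `k` with `3 k ≡ r n − 1 (mod 3 n)` the system
`A + B = C`, `A * B * C = D ^ n`, `gcd(A, B, C) = p ^ k` has a solution in nonzero
integers. -/
theorem exists_solution_of_mersenne_prime (n r p : ℕ) (hn : n.Prime) (hn3 : 3 < n)
    (hr : 1 ≤ r) (hr2 : r ≤ 2) (hnr : n % 3 = r)
    (hp : p = 2 ^ n - 1) (hpp : p.Prime)
    (k : ℕ) (hk : 0 < k) (hkmod : (3 * k) % (3 * n) = (r * n - 1) % (3 * n)) :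
    ∃ A B C D : ℤ, A ≠ 0 ∧ B ≠ 0 ∧ C ≠ 0 ∧ D ≠ 0 ∧
      A + B = C ∧ A * B * C = D ^ n ∧ Int.gcd A (Int.gcd B C) = p ^ k := by
  have hdvd : n ∣ 3 * k + 1 := by
    have hrn : 1 ≤ r * n := Nat.mul_pos hr (by omega)
    have h1 : (3 * k + 1) ≡ (r * n - 1 + 1) [MOD 3 * n] := Nat.ModEq.add_right 1 hkmod
    rw [Nat.sub_add_cancel hrn] at h1
    have h2 : (3 * k + 1) ≡ r * n [MOD n] := h1.of_mul_left 3
    exact (Nat.ModEq.dvd_iff h2 dvd_rfl).mpr (Dvd.intro_left r rfl)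
  obtain ⟨m, hm⟩ := hdvd
  have hodd : Odd n := hn.odd_of_ne_two (by omega)
  have hp0 : (p : ℤ) ≠ 0 := by exact_mod_cast hpp.ne_zero
  have hpz : (p : ℤ) = 2 ^ n - 1 := by
    rw [hp, Nat.cast_sub Nat.one_le_two_pow]; push_cast; rfl
  have hpk : (p : ℤ) ^ k ≠ 0 := pow_ne_zero _ hp0
  refine ⟨p ^ k * 2 ^ n, -p ^ k, p ^ k * p, -(2 * p ^ m), mul_ne_zero hpk (by positivity),
    neg_ne_zero.mpr hpk, mul_ne_zero hpk hp0,
    neg_ne_zero.mpr (mul_ne_zero two_ne_zero (pow_ne_zero _ hp0)), ?_, ?_, ?_⟩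
  · rw [show (p : ℤ) ^ k * p = p ^ k * (2 ^ n - 1) by rw [← hpz]]; ring
  · rw [hodd.neg_pow, mul_pow, ← pow_mul, mul_comm m n, ← hm]; ring
  · have e : Int.gcd (-(p : ℤ) ^ k) (p ^ k * p) = p ^ k := by
      rw [Int.neg_gcd, Int.gcd_eq_natAbs]
      simp [Int.natAbs_mul, Int.natAbs_pow]
    rw [e, Int.gcd_eq_natAbs]
    simp [Int.natAbs_mul, Int.natAbs_pow]
end

section
/- For every integer n ≥ 3, the following two assertions are equivalent: (i) there are no positive integers A, B, C, D with A + B = C, A·B·C = D^n, and gcd(A, B, C) = 1; (ii) there are no positive integers x, y, z with x^n + y^n = z^n. -/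
/-- For `n ≥ 3`, the insolubility of the system `A + B = C`, `A * B * C = D ^ n`,
`gcd(A, B, C) = 1` in positive integers is equivalent to Fermat's Last Theorem for
exponent `n`. -/
theorem system_coprime_iff_flt (n : ℕ) (hn : 3 ≤ n) :
    (¬ ∃ A B C D : ℕ, 0 < A ∧ 0 < B ∧ 0 < C ∧ 0 < D ∧
        A + B = C ∧ A * B * C = D ^ n ∧ Nat.gcd A (Nat.gcd B C) = 1) ↔
    (¬ ∃ x y z : ℕ, 0 < x ∧ 0 < y ∧ 0 < z ∧ x ^ n + y ^ n = z ^ n) := by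
  have hn0 : n ≠ 0 := by omega
  refine not_congr ⟨?_, ?_⟩
  · rintro ⟨A, B, C, D, hA, hB, hC, hD, hs, hp, hg⟩
    have hAB : Nat.Coprime A B := by
      have h : Nat.gcd A B ∣ Nat.gcd A (Nat.gcd B C) := by
        refine Nat.dvd_gcd (Nat.gcd_dvd_left _ _) (Nat.dvd_gcd (Nat.gcd_dvd_right _ _) ?_)
        rw [← hs]
        exact dvd_add (Nat.gcd_dvd_left _ _) (Nat.gcd_dvd_right _ _)
      rw [hg] at h
      exact Nat.dvd_one.mp h
    have hAC : Nat.Coprime A C := by rw [← hs]; simpa using hAB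
    have hBC : Nat.Coprime B C := by rw [← hs]; simpa using hAB.symm
    have key : ∀ a b : ℕ, Nat.Coprime a b → a * b = D ^ n → ∃ d, a = d ^ n := fun a b h e =>
      exists_eq_pow_of_mul_eq_pow (Nat.isUnit_iff.mpr h) e
    obtain ⟨x, rfl⟩ := key A (B * C) (Nat.Coprime.mul_right hAB hAC) (by rw [← hp]; ring)
    obtain ⟨y, rfl⟩ := key B (x ^ n * C) (Nat.Coprime.mul_right hAB.symm hBC) (by rw [← hp]; ring)
    obtain ⟨z, rfl⟩ := key C (x ^ n * y ^ n) (Nat.Coprime.mul_right hAC.symm hBC.symm)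
      (by rw [← hp]; ring)
    have pos : ∀ t : ℕ, 0 < t ^ n → 0 < t := fun t ht => by
      rcases Nat.eq_zero_or_pos t with rfl | h
      · simp [hn0] at ht
      · exact h
    exact ⟨x, y, z, pos x hA, pos y hB, pos z hC, hs⟩
  · rintro ⟨x, y, z, hx, hy, hz, h⟩
    obtain ⟨g, a, b, hgpos, hab, rfl, rfl⟩ := Nat.exists_coprime' (Nat.gcd_pos_of_pos_left y hx)
    have hgz : g ∣ z := by
      rw [← Nat.pow_dvd_pow_iff hn0, ← h]
      exact dvd_add (pow_dvd_pow_of_dvd (dvd_mul_left _ _) n)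
        (pow_dvd_pow_of_dvd (dvd_mul_left _ _) n)
    obtain ⟨c, rfl⟩ := hgz
    have ha : 0 < a := Nat.pos_of_mul_pos_right hx
    have hb : 0 < b := Nat.pos_of_mul_pos_right hy
    have hc : 0 < c := Nat.pos_of_mul_pos_left hz
    have hE : a ^ n + b ^ n = c ^ n := by
      have hgn : 0 < g ^ n := by positivity
      apply Nat.eq_of_mul_eq_mul_left hgn
      rw [mul_pow, mul_pow, mul_pow] at h
      linarith
    refine ⟨a ^ n, b ^ n, c ^ n, a * b * c, by positivity, by positivity, by positivity,
      by positivity, hE, by ring, ?_⟩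
    exact Nat.Coprime.coprime_dvd_right (Nat.gcd_dvd_left _ _) (Nat.Coprime.pow n n hab)
end

section
/- Let R be a commutative ring, and let t, u, k, a, c, s be elements of R satisfying s² = t and t·u² = 1 + 4k³. Define A = u·t·a + (a − 2k³·c)·s, B = u·t·c − (2a + c)·s, C = u·t·(a + c) − (a + (2k³ + 1)·c)·s, and D = u·t·k·c − k·(2a + c)·s. Then A + B = C and A·B·C = D³. -/
/-- The algebraic identity underlying solutions of `A + B = C`, `A * B * C = D ^ 3`
in `ℚ(√t)`: in any commutative ring, with `s ^ 2 = t` and `t * u ^ 2 = 1 + 4 k ^ 3`,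
the displayed `A`, `B`, `C`, `D` satisfy `A + B = C` and `A * B * C = D ^ 3`. -/
theorem cubic_identity_in_comm_ring {R : Type*} [CommRing R]
    (t u k a c s : R) (hs : s ^ 2 = t) (htu : t * u ^ 2 = 1 + 4 * k ^ 3) :
    (u * t * a + (a - 2 * k ^ 3 * c) * s) + (u * t * c - (2 * a + c) * s)
      = u * t * (a + c) - (a + (2 * k ^ 3 + 1) * c) * s ∧
    (u * t * a + (a - 2 * k ^ 3 * c) * s) * (u * t * c - (2 * a + c) * s)
        * (u * t * (a + c) - (a + (2 * k ^ 3 + 1) * c) * s)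
      = (u * t * k * c - k * (2 * a + c) * s) ^ 3 := by
  subst hs
  refine ⟨by ring, ?_⟩
  linear_combination (u * s ^ 2 * c - (2 * a + c) * s) * s ^ 2 * (a * (a + c) - k ^ 3 * c ^ 2) * htu
end
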